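/- Let Ω = ℝ^d/ℤ^d, m ∈ ℕ*, α_1,…,α_m > 0, and let h : Ω → ℝ be a Lipschitz continuous kernel with ĥ(ξ) ≠ 0 for all ξ ∈ ℤ^d. For T > 0 let μ*_T be any minimizer of N_h(μ − π) over μ ∈ 𝓜(𝓟_T^{m,∞}), where π is a Borel probability measure on Ω. Then W₁(𝓜(𝓟_T^{m,∞}), π) = O(T^{−m/(m(d+1)−1)}) as T → ∞; consequently (i) μ*_T converges weakly to π as T → ∞ and (ii) N_h(μ*_T − π) = O(T^{−m/(m(d+1)−1)}). -/

import Mathlib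

open MeasureTheory Filter Topology
open scoped NNReal ENNReal

noncomputable section

/-- The `d`-dimensional torus `Ω = ℝ^d/ℤ^d`. -/
abbrev Torus (d : ℕ) : Type := Fin d → AddCircle (1 : ℝ)

/-- Convolution `(h ⋆ μ)(x) = ∫ h(x−y) dμ(y)` of a function with a finite signed
measure, via the Jordan decomposition of `μ`. -/
def convSigned {d : ℕ} (h : Torus d → ℝ) (μ : SignedMeasure (Torus d)) (x : Torus d) : ℝ :=
  ∫ y, h (x - y) ∂μ.toJordanDecomposition.posPart -
    ∫ y, h (x - y) ∂μ.toJordanDecomposition.negPart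

/-- `N_h(μ) = ‖h ⋆ μ‖_{L²(Ω)}` for a signed measure `μ`. -/
def nhSigned {d : ℕ} (h : Torus d → ℝ) (μ : SignedMeasure (Torus d)) : ℝ :=
  Real.sqrt (∫ x, (convSigned h μ x) ^ 2)

/-- The total variation norm `‖μ‖_TV` of a signed measure. -/
def tvNorm {d : ℕ} (μ : SignedMeasure (Torus d)) : ℝ := (μ.totalVariation Set.univ).toReal

/-- The integral `∫ f dμ` of a function against a signed measure. -/
def signedIntegral {d : ℕ} (μ : SignedMeasure (Torus d)) (f : Torus d → ℝ) : ℝ :=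
  ∫ y, f y ∂μ.toJordanDecomposition.posPart - ∫ y, f y ∂μ.toJordanDecomposition.negPart

/-- The Fourier coefficient `ĥ(ξ) = ∫_Ω e^{−2πi⟨ξ,x⟩} h(x) dx`, `ξ ∈ ℤ^d`. -/
def torusFourierCoeff {d : ℕ} (h : Torus d → ℝ) (ξ : Fin d → ℤ) : ℂ :=
  ∫ x : Torus d, (∏ i, fourier (-(ξ i)) (x i)) * (h x : ℂ)

/-- `(h ⋆ (μ − ν))(x)` for two (finite) measures `μ, ν`. -/
def convDiff {d : ℕ} (h : Torus d → ℝ) (μ ν : Measure (Torus d)) (x : Torus d) : ℝ :=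
  ∫ y, h (x - y) ∂μ - ∫ y, h (x - y) ∂ν

/-- `N_h(μ − ν) = ‖h ⋆ (μ − ν)‖_{L²(Ω)}`. -/
def nhDist {d : ℕ} (h : Torus d → ℝ) (μ ν : Measure (Torus d)) : ℝ :=
  Real.sqrt (∫ x, (convDiff h μ ν x) ^ 2)

/-- The L¹ Wasserstein (Kantorovich) distance: infimum of `∫ dist(x,y) dc` over
all couplings `c` of `μ` and `ν`. -/
def W1 {d : ℕ} (μ ν : Measure (Torus d)) : ℝ :=
  sInf { r | ∃ c : Measure (Torus d × Torus d),
    c.map Prod.fst = μ ∧ c.map Prod.snd = ν ∧ r = ∫ p, dist p.1 p.2 ∂c }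

/-- The set `𝓜(Ω^N)` of `N`-point measures `(1/N) ∑ δ_{p_i}`. -/
def nPointMeasures (d N : ℕ) : Set (Measure (Torus d)) :=
  { μ | ∃ p : Fin N → Torus d, μ = (N : ℝ≥0∞)⁻¹ • ∑ i, Measure.dirac (p i) }

/-- Hausdorff distance between two sets of measures with respect to the metric
`(μ, ν) ↦ N_h(μ − ν)`. -/
def hausNh {d : ℕ} (h : Torus d → ℝ) (A B : Set (Measure (Torus d))) : ℝ :=
  max (sSup ((fun μ => sInf ((fun ν => nhDist h μ ν) '' B)) '' A))
      (sSup ((fun ν => sInf ((fun μ => nhDist h μ ν) '' A)) '' B))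

/-- Coordinatewise projection `ℝ^d → ℝ^d/ℤ^d`. -/
def projT {d : ℕ} (v : EuclideanSpace ℝ (Fin d)) : Torus d :=
  fun i => (v i : AddCircle (1 : ℝ))

/-- The admissible curve set `𝓟_T^{m,∞}`: torus-valued curves on `[0,T]` admitting a lift
`p ∈ (W^{m,∞}([0,T]))^d` (i.e. `p ∈ C^{m-1}` with `α_m`-Lipschitz `(m−1)`-th derivative,
which is exactly `W^{m,∞}` with `‖p^{(m)}‖_∞ ≤ α_m`) such that `‖p^{(i)}‖_∞ ≤ α_i` for
`i = 1, …, m`. -/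
def InP (d : ℕ) (T : ℝ) (m : ℕ) (α : ℕ → ℝ) (q : ℝ → Torus d) : Prop :=
  ∃ p : ℝ → EuclideanSpace ℝ (Fin d),
    (∀ t ∈ Set.Icc 0 T, q t = projT (p t)) ∧
    ContDiffOn ℝ (m - 1) p (Set.Icc 0 T) ∧
    (∀ i, 1 ≤ i → i ≤ m - 1 →
      ∀ t ∈ Set.Icc 0 T, ‖iteratedDerivWithin i p (Set.Icc 0 T) t‖ ≤ α i) ∧
    LipschitzOnWith (Real.toNNReal (α m))
      (iteratedDerivWithin (m - 1) p (Set.Icc 0 T)) (Set.Icc 0 T)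

/-- `γ_T`: the uniform (normalized Lebesgue) probability measure on `[0, T]`. -/
def gammaT (T : ℝ) : Measure ℝ := (ENNReal.ofReal T)⁻¹ • (volume.restrict (Set.Icc 0 T))

/-! ### A line on the torus that is `1/n`-dense at `n ^ d` equally spaced parameters -/

lemma exists_int_forall_abs_sub_le {n : ℕ} (hn : 0 < n) (d : ℕ) (y : ℕ → ℝ) :
    ∃ k : ℤ, ∀ j < d, ∃ z : ℤ, |(k : ℝ) / n ^ d * n ^ j - y j - z| ≤ 1 / n := by
  have hn' : (0 : ℝ) < n := by exact_mod_cast hn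
  induction d generalizing y with
  | zero => exact ⟨0, fun j hj => absurd hj (Nat.not_lt_zero j)⟩
  | succ d ih =>
    obtain ⟨k, hk⟩ := ih fun j => y (j + 1)
    set b : ℤ := ⌊n * y 0 - k / n ^ d⌋ with hb
    refine ⟨k + n ^ d * b, fun j hj => ?_⟩
    have hsplit : ((k + n ^ d * b : ℤ) : ℝ) / n ^ (d + 1) * n ^ j =
        (k / n ^ d + b) * (n ^ j / n) := by
      push_cast
      field_simp
      ring
    rcases j with _ | j
    · refine ⟨0, ?_⟩
      have h1 := Int.floor_le (n * y 0 - k / n ^ d : ℝ)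
      have h2 := Int.lt_floor_add_one (n * y 0 - k / n ^ d : ℝ)
      rw [← hb] at h1 h2
      have h3 : (k / n ^ d + b) * ((n : ℝ) ^ 0 / n) - y 0 - (0 : ℤ) =
          (k / n ^ d + b - n * y 0) / n := by
        push_cast
        field_simp
        ring
      rw [hsplit, h3, abs_div, abs_of_pos hn']
      gcongr
      rw [abs_le]
      constructor <;> linarith
    · obtain ⟨z, hz⟩ := hk j (by omega)
      refine ⟨z + b * n ^ j, ?_⟩
      rw [hsplit]
      convert hz using 2
      push_cast
      field_simp
      ring

/-- The direction `(1, n, …, n ^ (d - 1))`. -/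
def lineDir (d n : ℕ) : EuclideanSpace ℝ (Fin d) := WithLp.toLp 2 fun j => (n : ℝ) ^ (j : ℕ)

lemma norm_lineDir_le {d n : ℕ} (hn : 0 < n) : ‖lineDir d n‖ ≤ d * (n : ℝ) ^ d / n := by
  have hn' : (1 : ℝ) ≤ n := by exact_mod_cast hn
  rcases Nat.eq_zero_or_pos d with rfl | hd
  · simp [Subsingleton.elim (lineDir 0 n) 0]
  have hd' : (1 : ℝ) ≤ d := by exact_mod_cast hd
  obtain ⟨e, rfl⟩ : ∃ e, d = e + 1 := ⟨d - 1, by omega⟩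
  have h1 : ((e + 1 : ℕ) : ℝ) * (n : ℝ) ^ (e + 1) / n = ((e + 1 : ℕ) : ℝ) * n ^ e := by
    field_simp
    ring
  rw [h1, EuclideanSpace.norm_eq]
  refine Real.sqrt_le_iff.2 ⟨by positivity, ?_⟩
  calc ∑ i : Fin (e + 1), ‖lineDir (e + 1) n i‖ ^ 2 ≤ ∑ _i : Fin (e + 1), ((n : ℝ) ^ e) ^ 2 := by
        refine Finset.sum_le_sum fun i _ => ?_
        have : lineDir (e + 1) n i = (n : ℝ) ^ (i : ℕ) := rfl
        rw [this, Real.norm_of_nonneg (by positivity)]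
        gcongr
        omega
    _ = ((e + 1 : ℕ) : ℝ) * ((n : ℝ) ^ e) ^ 2 := by simp
    _ ≤ (((e + 1 : ℕ) : ℝ) * n ^ e) ^ 2 := by
        rw [mul_pow]
        gcongr
        nlinarith

lemma AddCircle.dist_coe_le (a b : ℝ) (z : ℤ) :
    dist (a : AddCircle (1 : ℝ)) (b : AddCircle (1 : ℝ)) ≤ |a - b - z| := by
  rw [dist_eq_norm, ← AddCircle.coe_sub, UnitAddCircle.norm_eq]
  exact round_le _ _

lemma exists_lt_dist_projT_le {d n : ℕ} (hn : 0 < n) (x : Torus d) :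
    ∃ k < n ^ d, dist (projT (((k : ℝ) / n ^ d) • lineDir d n)) x ≤ 1 / n := by
  have hn' : (0 : ℝ) < n := by exact_mod_cast hn
  have hx : ∀ j, ∃ y : ℝ, (y : AddCircle (1 : ℝ)) = x j := fun j => QuotientAddGroup.mk_surjective _
  choose y hy using hx
  obtain ⟨k, hk⟩ := exists_int_forall_abs_sub_le hn d fun j => if h : j < d then y ⟨j, h⟩ else 0
  have hN : (0 : ℤ) < (n : ℤ) ^ d := by positivity
  have hmod := Int.emod_nonneg k hN.ne'
  have hlt := Int.emod_lt_of_pos k hN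
  refine ⟨(k % (n : ℤ) ^ d).toNat, by zify; rwa [Int.toNat_of_nonneg hmod], ?_⟩
  refine (dist_pi_le_iff (by positivity)).2 fun j => ?_
  obtain ⟨z, hz⟩ := hk j j.2
  rw [← hy j]
  have hcast : (((k % (n : ℤ) ^ d).toNat : ℕ) : ℝ) = k - n ^ d * (k / (n : ℤ) ^ d : ℤ) := by
    have h1 : (((k % (n : ℤ) ^ d).toNat : ℕ) : ℝ) = ((k % (n : ℤ) ^ d : ℤ) : ℝ) := by
      exact_mod_cast congrArg (Int.cast (R := ℝ)) (Int.toNat_of_nonneg hmod)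
    rw [h1, Int.emod_def]
    push_cast
    ring
  refine (AddCircle.dist_coe_le _ _ (z - n ^ (j : ℕ) * (k / (n : ℤ) ^ d))).trans
    (le_of_eq_of_le ?_ hz)
  simp only [j.2, dite_true, Fin.eta, PiLp.smul_apply, smul_eq_mul, hcast, lineDir]
  congr 1
  push_cast
  field_simp
  ring

lemma continuous_projT {d : ℕ} : Continuous (projT (d := d)) := by
  unfold projT
  exact continuous_pi fun i => (AddCircle.continuous_mk' 1).comp (by fun_prop)

lemma Torus.dist_le_one {d : ℕ} (x y : Torus d) : dist x y ≤ 1 := by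
  refine (dist_pi_le_iff zero_le_one).2 fun i => ?_
  rw [dist_eq_norm]
  refine (AddCircle.norm_le_half_period 1 one_ne_zero).trans ?_
  norm_num

/-! ### Smooth staircases -/

/-- A smooth step which is `0` on `(-∞, 1/4]` and `1` on `[3/4, ∞)`. -/
def smoothStep (x : ℝ) : ℝ := Real.smoothTransition (2 * x - 1 / 2)

lemma contDiff_smoothStep {n : ℕ∞} : ContDiff ℝ n smoothStep :=
  Real.smoothTransition.contDiff.comp (by fun_prop)

lemma smoothStep_of_nonpos {x : ℝ} (hx : x ≤ 0) : smoothStep x = 0 :=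
  Real.smoothTransition.zero_of_nonpos (by linarith)

lemma smoothStep_of_one_le {x : ℝ} (hx : 1 ≤ x) : smoothStep x = 1 :=
  Real.smoothTransition.one_of_one_le (by linarith)

lemma iteratedDeriv_smoothStep_eq_zero {i : ℕ} (hi : i ≠ 0) {x : ℝ} (hx : x ∉ Set.Ioo 0 1) :
    iteratedDeriv i smoothStep x = 0 := by
  rcases le_or_gt x 0 with h0 | h0
  · have : smoothStep =ᶠ[𝓝 x] fun _ => 0 := by
      filter_upwards [gt_mem_nhds (show x < 1 / 4 by linarith)] with y hy
      exact Real.smoothTransition.zero_of_nonpos (by linarith)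
    rw [this.iteratedDeriv_eq, iteratedDeriv_const, if_neg hi]
  · have h1 : 1 ≤ x := not_lt.1 fun h => hx ⟨h0, h⟩
    have : smoothStep =ᶠ[𝓝 x] fun _ => 1 := by
      filter_upwards [lt_mem_nhds (show 3 / 4 < x by linarith)] with y hy
      exact Real.smoothTransition.one_of_one_le (by linarith)
    rw [this.iteratedDeriv_eq, iteratedDeriv_const, if_neg hi]

lemma exists_abs_iteratedDeriv_smoothStep_le (i : ℕ) :
    ∃ C : ℝ, 0 ≤ C ∧ ∀ x ∈ Set.Icc (0 : ℝ) 1, |iteratedDeriv i smoothStep x| ≤ C := by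
  have hc : Continuous (iteratedDeriv i smoothStep) :=
    (contDiff_smoothStep (n := i)).continuous_iteratedDeriv i le_rfl
  obtain ⟨C, hC⟩ := isCompact_Icc.exists_bound_of_continuousOn (s := Set.Icc (0 : ℝ) 1)
    hc.continuousOn
  exact ⟨C, (norm_nonneg _).trans (hC 0 (by simp)), hC⟩

/-- A smooth function increasing by one on each of the intervals `[a k, a k + τ]`, `k < N`. -/
def staircase (N : ℕ) (τ : ℝ) (a : ℕ → ℝ) (t : ℝ) : ℝ :=
  ∑ k ∈ Finset.range N, smoothStep (τ⁻¹ * (t - a k))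

lemma contDiff_staircase (N : ℕ) (τ : ℝ) (a : ℕ → ℝ) {n : ℕ∞} :
    ContDiff ℝ n (staircase N τ a) := by
  unfold staircase
  exact ContDiff.sum fun k _ => contDiff_smoothStep.comp (by fun_prop)

lemma monotone_of_add_le_succ {a : ℕ → ℝ} {τ : ℝ} (hτ : 0 < τ) (ha : ∀ k, a k + τ ≤ a (k + 1)) :
    Monotone a :=
  monotone_nat_of_le_succ fun k => by linarith [ha k]

lemma staircase_eq {N : ℕ} {τ : ℝ} (hτ : 0 < τ) {a : ℕ → ℝ} (ha : ∀ k, a k + τ ≤ a (k + 1))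
    {k : ℕ} (hk : k < N) {t : ℝ} (h1 : ∀ j < k, a j + τ ≤ t) (h2 : t ≤ a k) :
    staircase N τ a t = k := by
  have hsum : ∀ j ∈ Finset.range N,
      smoothStep (τ⁻¹ * (t - a j)) = if j < k then 1 else 0 := by
    intro j _
    split_ifs with hj
    · apply smoothStep_of_one_le
      rw [inv_mul_eq_div, le_div_iff₀ hτ]
      linarith [h1 j hj]
    · apply smoothStep_of_nonpos
      have := monotone_of_add_le_succ hτ ha (not_lt.1 hj)
      exact mul_nonpos_of_nonneg_of_nonpos (by positivity) (by linarith)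
  rw [staircase, Finset.sum_congr rfl hsum, Finset.sum_boole]
  have : (Finset.range N).filter (· < k) = Finset.range k := by
    ext j
    simp only [Finset.mem_filter, Finset.mem_range]
    omega
  rw [this, Finset.card_range]

lemma abs_iteratedDeriv_staircase_le (N : ℕ) {τ : ℝ} (hτ : 0 < τ) {a : ℕ → ℝ}
    (ha : ∀ k, a k + τ ≤ a (k + 1)) {i : ℕ} (hi : i ≠ 0) {C : ℝ} (hC0 : 0 ≤ C)
    (hC : ∀ x ∈ Set.Icc (0 : ℝ) 1, |iteratedDeriv i smoothStep x| ≤ C) (t : ℝ) :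
    |iteratedDeriv i (staircase N τ a) t| ≤ C / τ ^ i := by
  have hterm : ∀ k, iteratedDeriv i (fun t => smoothStep (τ⁻¹ * (t - a k))) t =
      τ⁻¹ ^ i * iteratedDeriv i smoothStep (τ⁻¹ * (t - a k)) := by
    intro k
    rw [iteratedDeriv_comp_sub_const i (fun z => smoothStep (τ⁻¹ * z)) (a k),
      iteratedDeriv_comp_const_mul contDiff_smoothStep]
  have hsum : iteratedDeriv i (staircase N τ a) t =
      ∑ k ∈ Finset.range N, τ⁻¹ ^ i * iteratedDeriv i smoothStep (τ⁻¹ * (t - a k)) := by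
    refine (iteratedDeriv_fun_sum (f := fun k t => smoothStep (τ⁻¹ * (t - a k))) fun k _ =>
      (contDiff_smoothStep.comp
        (by fun_prop : ContDiff ℝ i fun t => τ⁻¹ * (t - a k))).contDiffAt).trans ?_
    exact Finset.sum_congr rfl fun k _ => hterm k
  have hmem : ∀ k, τ⁻¹ * (t - a k) ∈ Set.Ioo (0 : ℝ) 1 → a k < t ∧ t < a k + τ := by
    intro k hk
    rw [inv_mul_eq_div, Set.mem_Ioo, lt_div_iff₀ hτ, div_lt_iff₀ hτ] at hk
    constructor <;> linarith [hk.1, hk.2]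
  have hmono := monotone_of_add_le_succ hτ ha
  rw [hsum]
  by_cases h : ∃ k ∈ Finset.range N, τ⁻¹ * (t - a k) ∈ Set.Ioo (0 : ℝ) 1
  · obtain ⟨k, hkN, hk⟩ := h
    rw [Finset.sum_eq_single_of_mem k hkN, abs_mul, abs_of_nonneg (by positivity), inv_pow,
      inv_mul_eq_div]
    · gcongr
      exact hC _ ⟨hk.1.le, hk.2.le⟩
    · intro j _ hjk
      rw [iteratedDeriv_smoothStep_eq_zero hi, mul_zero]
      intro hj
      have h1 := hmem j hj
      have h2 := hmem k hk
      rcases lt_or_gt_of_ne hjk with h | h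
      · linarith [hmono (Nat.succ_le_of_lt h), ha j]
      · linarith [hmono (Nat.succ_le_of_lt h), ha k]
  · push Not at h
    rw [Finset.sum_eq_zero fun k hk => by
      rw [iteratedDeriv_smoothStep_eq_zero hi (h k hk), mul_zero], abs_zero]
    positivity

/-- A curve all of whose derivatives of orders `1, …, m` are bounded by `α` is admissible. -/
lemma inP_projT_smul {d m : ℕ} (hm : 1 ≤ m) {α : ℕ → ℝ} {T : ℝ} (hT : 0 < T) {f : ℝ → ℝ}
    (hf : ∀ n : ℕ, ContDiff ℝ n f) (v : EuclideanSpace ℝ (Fin d))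
    (hb : ∀ i, 1 ≤ i → i ≤ m → ∀ t, |iteratedDeriv i f t| * ‖v‖ ≤ α i) :
    InP d T m α fun t => projT (f t • v) := by
  have hp : ∀ n : ℕ, ContDiff ℝ n fun t => f t • v := fun n => (hf n).smul contDiff_const
  have hder : ∀ i t, iteratedDeriv i (fun t => f t • v) t = iteratedDeriv i f t • v :=
    fun i t => iteratedDeriv_smul_const (hf i).contDiffAt v
  have hwithin : ∀ i, ∀ t ∈ Set.Icc 0 T,
      iteratedDerivWithin i (fun t => f t • v) (Set.Icc 0 T) t =
        iteratedDeriv i (fun t => f t • v) t :=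
    fun i t ht => iteratedDerivWithin_eq_iteratedDeriv (uniqueDiffOn_Icc hT) (hp i).contDiffAt ht
  refine ⟨fun t => f t • v, fun t _ => rfl, ?_, ?_, ?_⟩
  · exact ((hp m).of_le tsub_le_self).contDiffOn
  · intro i h1 h2 t ht
    rw [hwithin i t ht, hder, norm_smul]
    exact hb i h1 (by omega) t
  · have hlip : LipschitzWith (Real.toNNReal (α m)) (iteratedDeriv (m - 1) fun t => f t • v) := by
      refine lipschitzWith_of_nnnorm_deriv_le
        ((hp m).differentiable_iteratedDeriv (m - 1) (by exact_mod_cast (by omega : m - 1 < m)))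
        fun t => ?_
      rw [← iteratedDeriv_succ, Nat.sub_add_cancel hm, hder]
      refine NNReal.coe_le_coe.1 (le_trans ?_ (Real.le_coe_toNNReal _))
      rw [coe_nnnorm, norm_smul]
      exact hb m hm le_rfl t
    intro x hx y hy
    rw [hwithin _ x hx, hwithin _ y hy]
    exact hlip x y

/-! ### Couplings -/

/-- If the masses of disjoint sets `I k` are proportional to those of the cells `A k` of a
partition, then there is a coupling which sends `I k` into `A k`. -/
lemma exists_coupling {E X : Type*} [MeasurableSpace E] [MeasurableSpace X]
    (γ : Measure E) (π : Measure X) [IsProbabilityMeasure γ] [IsProbabilityMeasure π]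
    {I : ℕ → Set E} {A : ℕ → Set X} (hI : ∀ k, MeasurableSet (I k)) (hA : ∀ k, MeasurableSet (A k))
    (hId : Pairwise (Function.onFun Disjoint I)) (hAd : Pairwise (Function.onFun Disjoint A))
    (hAu : ⋃ k, A k = Set.univ) (s : ℝ≥0∞) (hs : ∀ k, γ (I k) = s * π (A k)) :
    ∃ ρ : Measure (E × X), ρ.map Prod.fst = γ ∧ ρ.map Prod.snd = π ∧
      ∀ᵐ p ∂ρ, ∀ k, p.1 ∈ I k → p.2 ∈ A k := by
  have hIu : MeasurableSet (⋃ k, I k) := MeasurableSet.iUnion hI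
  have hmass : γ (⋃ k, I k) = s := by
    rw [measure_iUnion hId hI]
    simp_rw [hs]
    rw [ENNReal.tsum_mul_left, ← measure_iUnion hAd hA, hAu, measure_univ, mul_one]
  refine ⟨Measure.sum (fun k => (γ.restrict (I k)).prod (ProbabilityTheory.cond π (A k))) +
    (γ.restrict (⋃ k, I k)ᶜ).prod π, ?_, ?_, ?_⟩
  · rw [Measure.map_add _ _ measurable_fst, Measure.map_sum measurable_fst.aemeasurable]
    have : ∀ k, Measure.map Prod.fst ((γ.restrict (I k)).prod (ProbabilityTheory.cond π (A k))) =
        γ.restrict (I k) := by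
      intro k
      rw [Measure.map_fst_prod]
      by_cases h : π (A k) = 0
      · rw [Measure.restrict_eq_zero.2 (by rw [hs, h, mul_zero]), smul_zero]
      · have := ProbabilityTheory.cond_isProbabilityMeasure h
        rw [measure_univ, one_smul]
    simp_rw [this]
    rw [Measure.map_fst_prod, measure_univ, one_smul, ← Measure.restrict_iUnion hId hI,
      Measure.restrict_add_restrict_compl hIu]
  · rw [Measure.map_add _ _ measurable_snd, Measure.map_sum measurable_snd.aemeasurable]
    have : ∀ k, Measure.map Prod.snd ((γ.restrict (I k)).prod (ProbabilityTheory.cond π (A k))) =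
        s • π.restrict (A k) := by
      intro k
      rw [Measure.map_snd_prod, Measure.restrict_apply_univ, hs, ProbabilityTheory.cond, smul_smul]
      by_cases h : π (A k) = 0
      · rw [Measure.restrict_eq_zero.2 h, smul_zero, smul_zero]
      · rw [mul_assoc, ENNReal.mul_inv_cancel h (measure_ne_top _ _), mul_one]
    simp_rw [this]
    rw [Measure.map_snd_prod, Measure.restrict_apply_univ]
    have h2 : Measure.sum (fun k => s • π.restrict (A k)) = s • π := by
      have h3 : Measure.sum (fun k => s • π.restrict (A k)) =
          s • Measure.sum fun k => π.restrict (A k) := by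
        ext B hB
        simp [Measure.sum_apply _ hB, ENNReal.tsum_mul_left]
      rw [h3, ← Measure.restrict_iUnion hAd hA, hAu, Measure.restrict_univ]
    rw [h2, ← add_smul, ← hmass, measure_add_measure_compl hIu, measure_univ, one_smul]
  · rw [ae_add_measure_iff]
    constructor
    · rw [Measure.ae_sum_iff]
      intro k
      have h1 : ∀ᵐ p ∂(γ.restrict (I k)).prod (ProbabilityTheory.cond π (A k)), p.1 ∈ I k :=
        Measure.quasiMeasurePreserving_fst.ae (ae_restrict_mem (hI k))
      have h2 : ∀ᵐ p ∂(γ.restrict (I k)).prod (ProbabilityTheory.cond π (A k)), p.2 ∈ A k :=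
        Measure.quasiMeasurePreserving_snd.ae (ProbabilityTheory.ae_cond_mem (hA k))
      filter_upwards [h1, h2] with p hp1 hp2 j hj
      by_cases hjk : j = k
      · exact hjk ▸ hp2
      · exact absurd hp1 (Set.disjoint_left.1 (hId hjk) hj)
    · have h1 : ∀ᵐ p ∂(γ.restrict (⋃ k, I k)ᶜ).prod π, p.1 ∈ (⋃ k, I k)ᶜ :=
        Measure.quasiMeasurePreserving_fst.ae (ae_restrict_mem hIu.compl)
      filter_upwards [h1] with p hp k hk
      exact absurd (Set.mem_iUnion_of_mem k hk) hp

lemma exists_coupling_integral_dist_le {d : ℕ} {E : Type*} [MeasurableSpace E]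
    (γ : Measure E) (π : Measure (Torus d)) [IsProbabilityMeasure γ] [IsProbabilityMeasure π]
    {q : E → Torus d} (hq : Measurable q)
    {I : ℕ → Set E} {A : ℕ → Set (Torus d)} (hI : ∀ k, MeasurableSet (I k))
    (hA : ∀ k, MeasurableSet (A k))
    (hId : Pairwise (Function.onFun Disjoint I)) (hAd : Pairwise (Function.onFun Disjoint A))
    (hAu : ⋃ k, A k = Set.univ) {s : ℝ} (hs0 : 0 ≤ s)
    (hs : ∀ k, γ (I k) = ENNReal.ofReal s * π (A k))
    {ε : ℝ} (hε : 0 ≤ ε) (hdist : ∀ k, ∀ t ∈ I k, ∀ y ∈ A k, dist (q t) y ≤ ε) :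
    ∃ c : Measure (Torus d × Torus d), c.map Prod.fst = γ.map q ∧ c.map Prod.snd = π ∧
      ∫ p, dist p.1 p.2 ∂c ≤ ε + (1 - s) := by
  obtain ⟨ρ, h1, h2, h3⟩ := exists_coupling γ π hI hA hId hAd hAu (ENNReal.ofReal s) hs
  have hIu : MeasurableSet (⋃ k, I k) := MeasurableSet.iUnion hI
  have hmass : γ (⋃ k, I k) = ENNReal.ofReal s := by
    rw [measure_iUnion hId hI]
    simp_rw [hs]
    rw [ENNReal.tsum_mul_left, ← measure_iUnion hAd hA, hAu, measure_univ, mul_one]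
  have hρ : IsProbabilityMeasure ρ := by
    refine ⟨?_⟩
    rw [← Set.preimage_univ (f := Prod.fst), ← Measure.map_apply measurable_fst .univ, h1,
      measure_univ]
  have hm : Measurable (Prod.map q (id : Torus d → Torus d)) := hq.prodMap measurable_id
  refine ⟨ρ.map (Prod.map q id), ?_, ?_, ?_⟩
  · rw [Measure.map_map measurable_fst hm, ← h1, Measure.map_map hq measurable_fst]
    rfl
  · rw [Measure.map_map measurable_snd hm, ← h2]
    rfl
  · rw [integral_map hm.aemeasurable (by fun_prop)]
    set J : Set (E × Torus d) := Prod.fst ⁻¹' (⋃ k, I k)ᶜ with hJ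
    have hJm : MeasurableSet J := measurable_fst hIu.compl
    have hJρ : ρ.real J = 1 - s := by
      rw [Measure.real, hJ, ← Measure.map_apply measurable_fst hIu.compl, h1, ← Measure.real,
        probReal_compl_eq_one_sub hIu, Measure.real, hmass, ENNReal.toReal_ofReal hs0]
    calc ∫ p, dist (Prod.map q id p).1 (Prod.map q id p).2 ∂ρ
        ≤ ∫ p, (ε + J.indicator (fun _ => (1 : ℝ)) p) ∂ρ := by
          refine integral_mono_of_nonneg (ae_of_all _ fun p => dist_nonneg)
            ((integrable_const _).add ((integrable_const _).indicator hJm)) ?_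
          filter_upwards [h3] with p hp
          by_cases hpJ : p ∈ J
          · rw [Set.indicator_of_mem hpJ]
            exact (Torus.dist_le_one _ _).trans (by linarith)
          · rw [Set.indicator_of_notMem hpJ, add_zero]
            obtain ⟨k, hk⟩ : ∃ k, p.1 ∈ I k := by
              simpa [hJ] using hpJ
            exact hdist k _ hk _ (hp k hk)
      _ = ε + (1 - s) := by
          rw [integral_add (integrable_const _) ((integrable_const _).indicator hJm),
            integral_indicator_const _ hJm, hJρ]
          simp

/-! ### The approximation rate -/

lemma isProbabilityMeasure_gammaT {T : ℝ} (hT : 0 < T) : IsProbabilityMeasure (gammaT T) := by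
  refine ⟨?_⟩
  rw [gammaT, Measure.smul_apply, Measure.restrict_apply_univ, Real.volume_Icc, sub_zero,
    smul_eq_mul, ENNReal.inv_mul_cancel (by simpa using hT) ENNReal.ofReal_ne_top]

lemma exists_inP_coupling {d m : ℕ} (hm : 1 ≤ m) {α : ℕ → ℝ} {T : ℝ} (hT : 0 < T)
    (π : Measure (Torus d)) [IsProbabilityMeasure π] {n : ℕ} (hn : 0 < n) {τ : ℝ} (hτ : 0 < τ)
    (hτT : n ^ d * τ ≤ T) {C : ℕ → ℝ} (hC0 : ∀ i, 0 ≤ C i)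
    (hC : ∀ i, ∀ x ∈ Set.Icc (0 : ℝ) 1, |iteratedDeriv i smoothStep x| ≤ C i)
    (hα : ∀ i, 1 ≤ i → i ≤ m → d * C i ≤ α i * (n * τ ^ i)) :
    ∃ q : ℝ → Torus d, InP d T m α q ∧ ∃ c : Measure (Torus d × Torus d),
      c.map Prod.fst = (gammaT T).map q ∧ c.map Prod.snd = π ∧
        ∫ p, dist p.1 p.2 ∂c ≤ 1 / n + n ^ d * τ / T := by
  have hn' : (0 : ℝ) < n := by exact_mod_cast hn
  have := isProbabilityMeasure_gammaT hT
  set v := lineDir d n with hv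
  set x : ℕ → Torus d := fun k => projT (((k : ℝ) / n ^ d) • v) with hx
  classical
  have hcover : ∀ y : Torus d, ∃ k, k < n ^ d ∧ dist (x k) y ≤ 1 / n :=
    fun y => exists_lt_dist_projT_le hn y
  set κ : Torus d → ℕ := fun y => Nat.find (hcover y) with hκ
  have hκm : Measurable κ := by
    refine measurable_find hcover fun k => ?_
    exact (MeasurableSet.const _).inter
      (measurableSet_le (measurable_const.dist measurable_id) measurable_const)
  set A : ℕ → Set (Torus d) := fun k => κ ⁻¹' {k} with hA
  have hAm : ∀ k, MeasurableSet (A k) := fun k => hκm (measurableSet_singleton k)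
  have hAd : Pairwise (Function.onFun Disjoint A) := fun j k hjk =>
    Disjoint.preimage κ (by simpa using hjk)
  have hAu : ⋃ k, A k = Set.univ := by
    ext y
    simp [hA]
  have hA0 : ∀ k, n ^ d ≤ k → A k = ∅ := by
    intro k hk
    ext y
    simp only [hA, Set.mem_preimage, Set.mem_singleton_iff, Set.mem_empty_iff_false, iff_false]
    rintro rfl
    exact absurd (Nat.find_spec (hcover y)).1 (not_lt.2 hk)
  have hsum : ∑ k ∈ Finset.range (n ^ d), π.real (A k) = 1 := by
    have h1 : ∑' k, π (A k) = 1 := by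
      rw [← measure_iUnion hAd hAm, hAu, measure_univ]
    rw [tsum_eq_sum (s := Finset.range (n ^ d)) fun k hk => by
      rw [hA0 k (by simpa using hk), measure_empty]] at h1
    simp_rw [Measure.real]
    rw [← ENNReal.toReal_sum fun k _ => measure_ne_top _ _, h1, ENNReal.toReal_one]
  set S := T - n ^ d * τ with hS
  have hS0 : 0 ≤ S := sub_nonneg.2 hτT
  set b : ℕ → ℝ := fun k => ∑ j ∈ Finset.range k, (π.real (A j) * S + τ) with hb
  have hbs : ∀ k, b (k + 1) = b k + (π.real (A k) * S + τ) :=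
    fun k => Finset.sum_range_succ _ _
  have hwS : ∀ k, 0 ≤ π.real (A k) * S := fun k => mul_nonneg measureReal_nonneg hS0
  have hbmono : Monotone b := monotone_nat_of_le_succ fun k => by linarith [hbs k, hwS k]
  have hb0 : b 0 = 0 := by simp [hb]
  have hbN : b (n ^ d) = T := by
    simp only [hb, Finset.sum_add_distrib, ← Finset.sum_mul, hsum]
    simp [hS]
  set a : ℕ → ℝ := fun k => b k + π.real (A k) * S with ha
  have hab : ∀ k, a k + τ = b (k + 1) := fun k => by rw [hbs]; ring
  have haτ : ∀ k, a k + τ ≤ a (k + 1) := fun k => by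
    rw [hab]
    exact le_add_of_nonneg_right (hwS _)
  set I : ℕ → Set ℝ := fun k => Set.Ico (b k) (a k) with hI
  have hId : Pairwise (Function.onFun Disjoint I) := fun j k hjk =>
    (hbmono.pairwise_disjoint_on_Ico_succ hjk).mono
      (Set.Ico_subset_Ico_right (by rw [Nat.succ_eq_succ, Nat.succ_eq_add_one, ← hab]; linarith))
      (Set.Ico_subset_Ico_right (by rw [Nat.succ_eq_succ, Nat.succ_eq_add_one, ← hab]; linarith))
  have hIempty : ∀ k, n ^ d ≤ k → I k = ∅ := fun k hk => by
    simp [hI, ha, hA0 k hk]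
  have hγ : ∀ k, gammaT T (I k) = ENNReal.ofReal (S / T) * π (A k) := by
    intro k
    rcases lt_or_ge k (n ^ d) with hk | hk
    · have hsub : I k ⊆ Set.Icc 0 T := by
        intro t ht
        refine ⟨hb0 ▸ (hbmono (Nat.zero_le k)).trans ht.1, ht.2.le.trans ?_⟩
        rw [← hbN]
        exact le_trans (by linarith [hab k]) (hbmono (Nat.succ_le_of_lt hk))
      rw [gammaT, Measure.smul_apply, Measure.restrict_apply measurableSet_Ico,
        Set.inter_eq_left.2 hsub, Real.volume_Ico, smul_eq_mul, ha, add_sub_cancel_left,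
        ENNReal.ofReal_mul measureReal_nonneg, ofReal_measureReal, ENNReal.ofReal_div_of_pos hT,
        ENNReal.div_eq_inv_mul]
      ring
    · rw [hIempty k hk, hA0 k hk, measure_empty, measure_empty, mul_zero]
  set f : ℝ → ℝ := fun t => ((n : ℝ) ^ d)⁻¹ * staircase (n ^ d) τ a t with hf
  have hfc : ∀ i : ℕ, ContDiff ℝ i f := fun i =>
    contDiff_const.mul (contDiff_staircase (n ^ d) τ a)
  set q : ℝ → Torus d := fun t => projT (f t • v) with hq
  have hqP : InP d T m α q := by
    refine inP_projT_smul hm hT hfc v fun i hi1 him t => ?_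
    rw [hf, iteratedDeriv_const_mul_field, abs_mul, abs_of_pos (by positivity)]
    calc ((n : ℝ) ^ d)⁻¹ * |iteratedDeriv i (staircase (n ^ d) τ a) t| * ‖v‖
        ≤ ((n : ℝ) ^ d)⁻¹ * (C i / τ ^ i) * (d * (n : ℝ) ^ d / n) := by
          gcongr
          · exact mul_nonneg (by positivity) (div_nonneg (hC0 i) (by positivity))
          · exact abs_iteratedDeriv_staircase_le _ hτ haτ (by omega) (hC0 i) (hC i) t
          · exact norm_lineDir_le hn
      _ = d * C i / (n * τ ^ i) := by field_simp
      _ ≤ α i := (div_le_iff₀ (by positivity)).2 (hα i hi1 him)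
  have hqm : Measurable q :=
    (continuous_projT.comp ((hfc 0).continuous.smul continuous_const)).measurable
  refine ⟨q, hqP, ?_⟩
  obtain ⟨c, hc1, hc2, hc3⟩ := exists_coupling_integral_dist_le (gammaT T) π hqm
    (fun k => measurableSet_Ico) hAm hId hAd hAu (div_nonneg hS0 hT.le) hγ
    (show (0 : ℝ) ≤ 1 / n by positivity) fun k t ht y hy => by
      rcases lt_or_ge k (n ^ d) with hk | hk
      · have hft : f t = k / n ^ d := by
          rw [hf]
          dsimp only
          rw [staircase_eq hτ haτ hk
            (fun j hj => (hab j).le.trans ((hbmono (Nat.succ_le_of_lt hj)).trans ht.1)) ht.2.le]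
          ring
        have hqt : q t = x k := by rw [hq, hx]; dsimp only; rw [hft]
        have hyk : κ y = k := hy
        rw [hqt, ← hyk]
        exact (Nat.find_spec (hcover y)).2
      · exact absurd ht (Set.eq_empty_iff_forall_notMem.1 (hIempty k hk) t)
  refine ⟨c, hc1, hc2, hc3.trans (le_of_eq ?_)⟩
  rw [hS]
  field_simp
  ring

/-- The optimal transport cost to an arbitrary measure decays at the rate
`T ^ (-m / (m (d + 1) - 1))`. -/
lemma exists_rate {d : ℕ} (m : ℕ) (hm : 1 ≤ m) (α : ℕ → ℝ) (hα : ∀ i, 1 ≤ i → i ≤ m → 0 < α i)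
    (π : Measure (Torus d)) [IsProbabilityMeasure π] :
    ∃ C T₀ : ℝ, ∀ T ≥ T₀, ∃ q : ℝ → Torus d, InP d T m α q ∧
      ∃ c : Measure (Torus d × Torus d),
        c.map Prod.fst = (gammaT T).map q ∧ c.map Prod.snd = π ∧
          ∫ p, dist p.1 p.2 ∂c ≤ C * T ^ (-(m : ℝ) / ((m : ℝ) * ((d : ℝ) + 1) - 1)) := by
  choose C hC0 hC using exists_abs_iteratedDeriv_smoothStep_le
  rcases Nat.eq_zero_or_pos d with rfl | hd
  · refine ⟨0, 1, fun T hT => ?_⟩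
    have hT0 : 0 < T := by linarith
    have := isProbabilityMeasure_gammaT hT0
    refine ⟨fun t => projT ((0 : ℝ) • lineDir 0 1),
      inP_projT_smul hm hT0 (fun n => contDiff_const) _ fun i h1 h2 t => ?_,
      ((gammaT T).map fun t => projT ((0 : ℝ) • lineDir 0 1)).prod π, ?_, ?_, ?_⟩
    · rw [Subsingleton.elim (lineDir 0 1) 0, norm_zero, mul_zero]
      exact (hα i h1 h2).le
    · rw [Measure.map_fst_prod, measure_univ, one_smul]
    · have := Measure.isProbabilityMeasure_map (μ := gammaT T)
        (f := fun t : ℝ => projT ((0 : ℝ) • lineDir 0 1)) measurable_const.aemeasurable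
      rw [Measure.map_snd_prod, measure_univ, one_smul]
    · have hdist : ∀ p : Torus 0 × Torus 0, dist p.1 p.2 = 0 := fun p => by
        rw [Subsingleton.elim p.1 p.2, dist_self]
      simp [hdist]
  have hm' : (1 : ℝ) ≤ m := by exact_mod_cast hm
  have hd' : (1 : ℝ) ≤ d := by exact_mod_cast hd
  have hden : (0 : ℝ) < m * (d + 1) - 1 := by nlinarith
  set e : ℝ := m / (m * (d + 1) - 1) with he
  have he0 : 0 < e := by positivity
  set a : ℝ := 1 + ∑ i ∈ Finset.Icc 1 m, d * C i / α i with ha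
  have hterm : ∀ i ∈ Finset.Icc 1 m, 0 ≤ d * C i / α i := fun i hi => by
    rw [Finset.mem_Icc] at hi
    exact div_nonneg (mul_nonneg (by positivity) (hC0 i)) (hα i hi.1 hi.2).le
  have ha1 : 1 ≤ a := le_add_of_nonneg_right (Finset.sum_nonneg hterm)
  have hai : ∀ i, 1 ≤ i → i ≤ m → d * C i ≤ α i * a := by
    intro i h1 h2
    have h3 := Finset.single_le_sum hterm (Finset.mem_Icc.2 ⟨h1, h2⟩)
    rw [← div_le_iff₀' (hα i h1 h2)]
    linarith
  have hev : ∀ᶠ T : ℝ in atTop, 2 ^ d * a ≤ T ^ e := (tendsto_rpow_atTop he0).eventually_ge_atTop _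
  obtain ⟨T₁, hT₁⟩ := eventually_atTop.1 hev
  refine ⟨1 + 2 ^ d * a, max 1 T₁, fun T hT => ?_⟩
  have hT1 : 1 ≤ T := (le_max_left _ _).trans hT
  have hT0 : 0 < T := by linarith
  set x : ℝ := T ^ e with hx
  have hxa : 2 ^ d * a ≤ x := hT₁ T ((le_max_right _ _).trans hT)
  have hx1 : 1 ≤ x := Real.one_le_rpow hT1 he0.le
  have hx0 : 0 < x := by linarith
  set n : ℕ := ⌈x⌉₊ with hn
  have hxn : x ≤ n := Nat.le_ceil x
  have hn0 : 0 < n := Nat.ceil_pos.2 hx0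
  have hnx : (n : ℝ) ≤ 2 * x := by linarith [Nat.ceil_lt_add_one hx0.le]
  set r : ℝ := x ^ (-(1 / m : ℝ)) with hr
  have hr0 : 0 < r := Real.rpow_pos_of_pos hx0 _
  have hr1 : r ≤ 1 := Real.rpow_le_one_of_one_le_of_nonpos hx1 (by
    rw [neg_nonpos]; positivity)
  have hrm : x * r ^ m = 1 := by
    rw [hr, ← Real.rpow_natCast, ← Real.rpow_mul hx0.le]
    have : -(1 / m : ℝ) * m = -1 := by field_simp
    rw [this, Real.rpow_neg_one, mul_inv_cancel₀ hx0.ne']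
  have hTx : T = x ^ d * r * x := by
    rw [hr, ← Real.rpow_natCast, ← Real.rpow_add hx0, ← Real.rpow_add_one hx0.ne', hx,
      ← Real.rpow_mul hT0.le]
    have : e * (d + -(1 / m : ℝ) + 1) = 1 := by
      rw [he]
      field_simp
      ring
    rw [this, Real.rpow_one]
  have hcost : (n : ℝ) ^ d * (a * r) / T ≤ 2 ^ d * a / x := by
    rw [div_le_div_iff₀ hT0 hx0]
    calc (n : ℝ) ^ d * (a * r) * x ≤ (2 * x) ^ d * (a * r) * x := by gcongr
      _ = 2 ^ d * a * T := by rw [hTx, mul_pow]; ring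
  have hτT : (n : ℝ) ^ d * (a * r) ≤ T := by
    rw [← div_le_one hT0]
    exact hcost.trans ((div_le_one hx0).2 hxa)
  obtain ⟨q, hq, c, hc1, hc2, hc3⟩ := exists_inP_coupling hm hT0 π hn0
    (mul_pos (by linarith) hr0) hτT hC0 hC fun i h1 h2 => by
      refine (hai i h1 h2).trans (mul_le_mul_of_nonneg_left ?_ (hα i h1 h2).le)
      calc a = a * (x * r ^ m) := by rw [hrm, mul_one]
        _ ≤ a ^ i * (n * r ^ i) :=
          mul_le_mul (le_self_pow₀ ha1 (by omega))
            (mul_le_mul hxn (pow_le_pow_of_le_one hr0.le hr1 h2) (by positivity) (by positivity))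
            (by positivity) (by positivity)
        _ = n * (a * r) ^ i := by rw [mul_pow]; ring
  refine ⟨q, hq, c, hc1, hc2, hc3.trans ?_⟩
  have hxe : T ^ (-(m : ℝ) / ((m : ℝ) * ((d : ℝ) + 1) - 1)) = 1 / x := by
    rw [neg_div, Real.rpow_neg hT0.le, one_div]
  rw [hxe]
  calc 1 / (n : ℝ) + n ^ d * (a * r) / T ≤ 1 / x + 2 ^ d * a / x := by gcongr
    _ = (1 + 2 ^ d * a) * (1 / x) := by ring

/-! ### The kernel norm -/

lemma volume_torus (d : ℕ) : IsProbabilityMeasure (volume : Measure (Torus d)) := by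
  refine ⟨?_⟩
  rw [volume_pi, Measure.pi_univ]
  simp

lemma continuous_integral_sub {d : ℕ} {h : Torus d → ℝ} (hh : Continuous h)
    (μ : Measure (Torus d)) [IsFiniteMeasure μ] : Continuous fun x => ∫ y, h (x - y) ∂μ := by
  obtain ⟨M, hM⟩ := isCompact_univ.exists_bound_of_continuousOn hh.continuousOn
  refine continuous_of_dominated (bound := fun _ => M)
    (fun x => (hh.comp (continuous_const.sub continuous_id)).aestronglyMeasurable)
    (fun x => ae_of_all _ fun y => hM _ (Set.mem_univ _)) (integrable_const _)
    (ae_of_all _ fun y => hh.comp (continuous_id.sub continuous_const))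

lemma continuous_convDiff {d : ℕ} {h : Torus d → ℝ} (hh : Continuous h)
    (μ ν : Measure (Torus d)) [IsFiniteMeasure μ] [IsFiniteMeasure ν] :
    Continuous (convDiff h μ ν) :=
  (continuous_integral_sub hh μ).sub (continuous_integral_sub hh ν)

lemma Continuous.integrable_of_compactSpace {X F : Type*} [TopologicalSpace X] [CompactSpace X]
    [MeasurableSpace X] [OpensMeasurableSpace X] [NormedAddCommGroup F]
    [SecondCountableTopologyEither X F] {f : X → F} (hf : Continuous f)
    (μ : Measure X) [IsFiniteMeasure μ] : Integrable f μ :=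
  hf.integrable_of_hasCompactSupport (HasCompactSupport.of_compactSpace f)

/-- The kernel distance of two marginals is controlled by the transport cost of a coupling. -/
lemma nhDist_map_fst_map_snd_le {d : ℕ} {L : ℝ≥0} {h : Torus d → ℝ} (hLip : LipschitzWith L h)
    (c : Measure (Torus d × Torus d)) [IsFiniteMeasure c] :
    nhDist h (c.map Prod.fst) (c.map Prod.snd) ≤ L * ∫ p, dist p.1 p.2 ∂c := by
  have := volume_torus d
  set K : ℝ := L * ∫ p, dist p.1 p.2 ∂c with hK
  have hK0 : 0 ≤ K := mul_nonneg L.2 (integral_nonneg fun p => dist_nonneg)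
  have hh := hLip.continuous
  have hpt : ∀ x, |convDiff h (c.map Prod.fst) (c.map Prod.snd) x| ≤ K := by
    intro x
    have hc1 : Continuous fun y : Torus d => h (x - y) := by fun_prop
    rw [convDiff, integral_map measurable_fst.aemeasurable hc1.aestronglyMeasurable,
      integral_map measurable_snd.aemeasurable hc1.aestronglyMeasurable,
      ← integral_sub (Continuous.integrable_of_compactSpace (by fun_prop) c)
        (Continuous.integrable_of_compactSpace (by fun_prop) c), hK, ← integral_const_mul]
    refine abs_integral_le_integral_abs.trans (integral_mono
      (Continuous.integrable_of_compactSpace (by fun_prop) c)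
      (Continuous.integrable_of_compactSpace (by fun_prop) c) fun p => ?_)
    have := hLip.dist_le_mul (x - p.1) (x - p.2)
    rwa [dist_sub_left, Real.dist_eq] at this
  refine Real.sqrt_le_iff.2 ⟨hK0, ?_⟩
  have hcont := continuous_convDiff hh (c.map Prod.fst) (c.map Prod.snd)
  calc ∫ x, convDiff h (c.map Prod.fst) (c.map Prod.snd) x ^ 2 ≤ ∫ _x : Torus d, K ^ 2 :=
        integral_mono ((hcont.pow 2).integrable_of_compactSpace _) (integrable_const _)
          fun x => sq_le_sq.2 ((hpt x).trans (le_abs_self K))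
    _ = K ^ 2 := by simp

/-- The Fourier coefficients of `h ⋆ μ` are the products of those of `h` and `μ`. -/
lemma integral_mFourier_neg_mul_integral_sub {d : ℕ} {h : Torus d → ℝ} (hh : Continuous h)
    (μ : Measure (Torus d)) [IsFiniteMeasure μ] (ξ : Fin d → ℤ) :
    ∫ x : Torus d, UnitAddTorus.mFourier (-ξ) x * ((∫ y, h (x - y) ∂μ : ℝ) : ℂ) =
      torusFourierCoeff h ξ * ∫ y, UnitAddTorus.mFourier (-ξ) y ∂μ := by
  have := volume_torus d
  have hmul : ∀ x y : Torus d, UnitAddTorus.mFourier (-ξ) (x + y) =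
      UnitAddTorus.mFourier (-ξ) x * UnitAddTorus.mFourier (-ξ) y := by
    intro x y
    simp only [UnitAddTorus.mFourier, ContinuousMap.coe_mk, ← Finset.prod_mul_distrib]
    refine Finset.prod_congr rfl fun i _ => ?_
    simp [fourier_apply, AddCircle.toCircle_add]
  calc ∫ x : Torus d, UnitAddTorus.mFourier (-ξ) x * ((∫ y, h (x - y) ∂μ : ℝ) : ℂ)
      = ∫ x : Torus d, ∫ y, UnitAddTorus.mFourier (-ξ) x * (h (x - y) : ℂ) ∂μ := by
        refine integral_congr_ae (ae_of_all _ fun x => ?_)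
        dsimp only
        rw [integral_const_mul, ← integral_complex_ofReal]
    _ = ∫ y, ∫ x : Torus d, UnitAddTorus.mFourier (-ξ) x * (h (x - y) : ℂ) ∂volume ∂μ := by
        refine integral_integral_swap (Continuous.integrable_of_compactSpace ?_ _)
        simp only [Function.uncurry_def]
        fun_prop
    _ = ∫ y, torusFourierCoeff h ξ * UnitAddTorus.mFourier (-ξ) y ∂μ := by
        refine integral_congr_ae (ae_of_all _ fun y => ?_)
        dsimp only
        rw [← integral_add_right_eq_self _ y, torusFourierCoeff, ← integral_mul_const]
        refine integral_congr_ae (ae_of_all _ fun x => ?_)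
        dsimp only
        rw [add_sub_cancel_right, hmul]
        simp only [UnitAddTorus.mFourier, ContinuousMap.coe_mk, Pi.neg_apply]
        ring
    _ = _ := integral_const_mul _ _

lemma norm_torusFourierCoeff_mul_le_nhDist {d : ℕ} {h : Torus d → ℝ} (hh : Continuous h)
    (μ ν : Measure (Torus d)) [IsFiniteMeasure μ] [IsFiniteMeasure ν] (ξ : Fin d → ℤ) :
    ‖torusFourierCoeff h ξ‖ * ‖(∫ y, UnitAddTorus.mFourier (-ξ) y ∂μ) -
      ∫ y, UnitAddTorus.mFourier (-ξ) y ∂ν‖ ≤ nhDist h μ ν := by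
  have := volume_torus d
  have hμ := continuous_integral_sub hh μ
  have hν := continuous_integral_sub hh ν
  have hc := continuous_convDiff hh μ ν
  have h1 : torusFourierCoeff h ξ * ((∫ y, UnitAddTorus.mFourier (-ξ) y ∂μ) -
      ∫ y, UnitAddTorus.mFourier (-ξ) y ∂ν) =
        ∫ x : Torus d, UnitAddTorus.mFourier (-ξ) x * (convDiff h μ ν x : ℂ) := by
    rw [mul_sub, ← integral_mFourier_neg_mul_integral_sub hh,
      ← integral_mFourier_neg_mul_integral_sub hh,
      ← integral_sub (Continuous.integrable_of_compactSpace (by fun_prop) _)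
        (Continuous.integrable_of_compactSpace (by fun_prop) _)]
    refine integral_congr_ae (ae_of_all _ fun x => ?_)
    dsimp only
    rw [convDiff]
    push_cast
    ring
  rw [← norm_mul, h1]
  have h2 : ‖∫ x : Torus d, UnitAddTorus.mFourier (-ξ) x * (convDiff h μ ν x : ℂ)‖ ≤
      ∫ x, |convDiff h μ ν x| := by
    refine (norm_integral_le_integral_norm _).trans (integral_mono
      (Continuous.integrable_of_compactSpace (by fun_prop) _)
      (hc.abs.integrable_of_compactSpace _) fun x => ?_)
    dsimp only
    rw [norm_mul, Complex.norm_real, Real.norm_eq_abs]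
    refine mul_le_of_le_one_left (abs_nonneg _) ?_
    exact ((UnitAddTorus.mFourier (-ξ)).norm_coe_le_norm x).trans UnitAddTorus.mFourier_norm.le
  refine h2.trans (Real.le_sqrt_of_sq_le ?_)
  have h3 : (∫ x, |convDiff h μ ν x|) ^ 2 ≤ ∫ x, |convDiff h μ ν x| ^ 2 :=
    (even_two.convexOn_pow (𝕜 := ℝ)).map_integral_le (continuous_pow 2).continuousOn isClosed_univ
      (ae_of_all _ fun x => Set.mem_univ _) (hc.abs.integrable_of_compactSpace _)
      ((hc.abs.pow 2).integrable_of_compactSpace _)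
  simpa only [sq_abs] using h3

/-- Convergence of all Fourier coefficients implies weak convergence. -/
lemma tendsto_integral_of_tendsto_mFourier {d : ℕ} {ι : Type*} {l : Filter ι}
    {μ : ι → Measure (Torus d)} {π : Measure (Torus d)} [IsProbabilityMeasure π]
    (hμ : ∀ᶠ i in l, IsProbabilityMeasure (μ i))
    (hF : ∀ ξ : Fin d → ℤ, Tendsto (fun i => ∫ x, UnitAddTorus.mFourier ξ x ∂μ i) l
      (𝓝 (∫ x, UnitAddTorus.mFourier ξ x ∂π)))
    (f : C(Torus d, ℂ)) : Tendsto (fun i => ∫ x, f x ∂μ i) l (𝓝 (∫ x, f x ∂π)) := by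
  have hintegrable : ∀ (ν : Measure (Torus d)) [IsProbabilityMeasure ν] (g : C(Torus d, ℂ)),
      Integrable g ν := fun ν _ g => g.continuous.integrable_of_compactSpace ν
  have hspan : ∀ g ∈ Submodule.span ℂ (Set.range (UnitAddTorus.mFourier (d := Fin d))),
      Tendsto (fun i => ∫ x, g x ∂μ i) l (𝓝 (∫ x, g x ∂π)) := by
    intro g hg
    induction hg using Submodule.span_induction with
    | mem g hg =>
      obtain ⟨ξ, rfl⟩ := hg
      exact hF ξ
    | zero => simpa using tendsto_const_nhds
    | add g₁ g₂ _ _ h₁ h₂ =>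
      have : ∀ (ν : Measure (Torus d)) [IsProbabilityMeasure ν],
          ∫ x, (g₁ + g₂) x ∂ν = ∫ x, g₁ x ∂ν + ∫ x, g₂ x ∂ν :=
        fun ν _ => integral_add (hintegrable ν g₁) (hintegrable ν g₂)
      rw [this π]
      exact (h₁.add h₂).congr' (hμ.mono fun i hi => (this (μ i)).symm)
    | smul a g _ h =>
      simp only [ContinuousMap.smul_apply, integral_smul]
      exact h.const_smul a
  rw [Metric.tendsto_nhds]
  intro ε hε
  have hf : f ∈ closure (Submodule.span ℂ (Set.range (UnitAddTorus.mFourier (d := Fin d))) :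
      Set C(Torus d, ℂ)) := by
    rw [← Submodule.topologicalClosure_coe, UnitAddTorus.span_mFourier_closure_eq_top]
    trivial
  obtain ⟨g, hg, hfg⟩ := Metric.mem_closure_iff.1 hf (ε / 3) (by positivity)
  have happrox : ∀ (ν : Measure (Torus d)) [IsProbabilityMeasure ν],
      dist (∫ x, f x ∂ν) (∫ x, g x ∂ν) ≤ ε / 3 := by
    intro ν _
    rw [dist_eq_norm, ← integral_sub (hintegrable ν f) (hintegrable ν g)]
    refine (norm_integral_le_of_norm_le_const (C := ε / 3) (ae_of_all _ fun x => ?_)).trans ?_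
    · rw [← dist_eq_norm]
      exact (ContinuousMap.dist_apply_le_dist x).trans hfg.le
    · simp
  filter_upwards [hμ, Metric.tendsto_nhds.1 (hspan g hg) (ε / 3) (by positivity)] with i hi hgi
  have h1 := happrox (μ i)
  have h2 := happrox π
  rw [dist_comm] at h2
  linarith [dist_triangle4 (∫ x, f x ∂μ i) (∫ x, g x ∂μ i) (∫ x, g x ∂π) (∫ x, f x ∂π)]

lemma InP.isProbabilityMeasure_map {d m : ℕ} {α : ℕ → ℝ} {T : ℝ} (hT : 0 < T) {q : ℝ → Torus d}
    (hq : InP d T m α q) : IsProbabilityMeasure ((gammaT T).map q) := by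
  obtain ⟨p, hqp, hp, -, -⟩ := hq
  have := isProbabilityMeasure_gammaT hT
  refine Measure.isProbabilityMeasure_map ?_
  refine AEMeasurable.smul_measure ?_ _
  refine AEMeasurable.congr ?_ ((ae_restrict_iff' measurableSet_Icc).2
    (ae_of_all _ fun t ht => (hqp t ht).symm))
  exact (continuous_projT.comp_continuousOn hp.continuousOn).aemeasurable measurableSet_Icc

lemma W1_le {d : ℕ} {μ ν : Measure (Torus d)} {c : Measure (Torus d × Torus d)}
    (h1 : c.map Prod.fst = μ) (h2 : c.map Prod.snd = ν) : W1 μ ν ≤ ∫ p, dist p.1 p.2 ∂c := by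
  refine csInf_le ⟨0, ?_⟩ ⟨c, h1, h2, rfl⟩
  rintro _ ⟨c, -, -, rfl⟩
  exact integral_nonneg fun p => dist_nonneg

lemma W1_nonneg {d : ℕ} (μ ν : Measure (Torus d)) : 0 ≤ W1 μ ν := by
  refine Real.sInf_nonneg ?_
  rintro _ ⟨c, -, -, rfl⟩
  exact integral_nonneg fun p => dist_nonneg

/-- For a Lipschitz kernel `h` with nonvanishing Fourier coefficients,
`W₁(𝓜(𝓟_T^{m,∞}), π) = O(T^{−m/(m(d+1)−1)})` as `T → ∞`; consequently any choice of
minimizers `μ*_T` of `N_h(· − π)` over `𝓜(𝓟_T^{m,∞})` satisfies (i) `μ*_T ⇀ π` weakly as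
`T → ∞` and (ii) `N_h(μ*_T − π) = O(T^{−m/(m(d+1)−1)})`. -/
theorem continuous_line_drawing_consistency {d : ℕ} (m : ℕ) (hm : 1 ≤ m)
    (α : ℕ → ℝ) (hα : ∀ i, 1 ≤ i → i ≤ m → 0 < α i)
    (L : ℝ≥0) (h : Torus d → ℝ) (hLip : LipschitzWith L h)
    (hfc : ∀ ξ : Fin d → ℤ, torusFourierCoeff h ξ ≠ 0)
    (π : Measure (Torus d)) [IsProbabilityMeasure π] :
    (∃ C T₀ : ℝ, ∀ T ≥ T₀,
        sInf { r : ℝ | ∃ q : ℝ → Torus d, InP d T m α q ∧ r = W1 ((gammaT T).map q) π } ≤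
          C * T ^ (-(m : ℝ) / ((m : ℝ) * ((d : ℝ) + 1) - 1))) ∧
      ∀ μT : ℝ → Measure (Torus d),
        (∀ T, 0 < T →
          (∃ q : ℝ → Torus d, InP d T m α q ∧ μT T = (gammaT T).map q) ∧
            ∀ q : ℝ → Torus d, InP d T m α q →
              nhDist h (μT T) π ≤ nhDist h ((gammaT T).map q) π) →
        ((∀ f : C(Torus d, ℝ),
            Tendsto (fun T => ∫ x, f x ∂(μT T)) atTop (𝓝 (∫ x, f x ∂π))) ∧
          ∃ C T₀ : ℝ, ∀ T ≥ T₀,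
            nhDist h (μT T) π ≤ C * T ^ (-(m : ℝ) / ((m : ℝ) * ((d : ℝ) + 1) - 1))) := by
  obtain ⟨C, T₀, hC⟩ := exists_rate m hm α hα π
  refine ⟨⟨C, T₀, fun T hT => ?_⟩, fun μT hμT => ?_⟩
  · obtain ⟨q, hq, c, hc1, hc2, hc3⟩ := hC T hT
    refine csInf_le_of_le ⟨0, ?_⟩ ⟨q, hq, rfl⟩ ((W1_le hc1 hc2).trans hc3)
    rintro _ ⟨q, -, rfl⟩
    exact W1_nonneg _ _
  have hrate : ∀ T ≥ max 1 T₀, nhDist h (μT T) π ≤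
      L * C * T ^ (-(m : ℝ) / ((m : ℝ) * ((d : ℝ) + 1) - 1)) := by
    intro T hT
    have hT0 : 0 < T := lt_of_lt_of_le one_pos ((le_max_left _ _).trans hT)
    obtain ⟨q, hq, c, hc1, hc2, hc3⟩ := hC T ((le_max_right _ _).trans hT)
    have hprob : IsProbabilityMeasure c := by
      refine ⟨?_⟩
      rw [← Set.preimage_univ (f := Prod.snd), ← Measure.map_apply measurable_snd .univ, hc2,
        measure_univ]
    have h1 := nhDist_map_fst_map_snd_le hLip c
    rw [hc1, hc2] at h1
    rw [mul_assoc]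
    exact ((hμT T hT0).2 q hq).trans (h1.trans (mul_le_mul_of_nonneg_left hc3 L.2))
  refine ⟨fun f => ?_, L * C, max 1 T₀, hrate⟩
  have hprob : ∀ T, 0 < T → IsProbabilityMeasure (μT T) := by
    intro T hT
    obtain ⟨q, hq, hμ⟩ := (hμT T hT).1
    exact hμ ▸ hq.isProbabilityMeasure_map hT
  rcases Nat.eq_zero_or_pos d with rfl | hd
  · have hconst : ∀ x, f x = f 0 := fun x => congrArg f (Subsingleton.elim x 0)
    simp_rw [hconst]
    refine tendsto_const_nhds.congr' ?_
    filter_upwards [eventually_gt_atTop 0] with T hT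
    have := hprob T hT
    simp
  have hm' : (1 : ℝ) ≤ m := by exact_mod_cast hm
  have hd' : (1 : ℝ) ≤ d := by exact_mod_cast hd
  have hexp : 0 < (m : ℝ) / ((m : ℝ) * ((d : ℝ) + 1) - 1) :=
    div_pos (by linarith) (by nlinarith)
  have hlim : Tendsto (fun T => nhDist h (μT T) π) atTop (𝓝 0) := by
    have h1 := (tendsto_rpow_neg_atTop hexp).const_mul (L * C : ℝ)
    rw [mul_zero] at h1
    refine squeeze_zero' (Eventually.of_forall fun T => Real.sqrt_nonneg _) ?_ h1
    filter_upwards [eventually_ge_atTop (max 1 T₀)] with T hT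
    rw [← neg_div]
    exact hrate T hT
  have hF : ∀ ξ : Fin d → ℤ, Tendsto (fun T => ∫ x, UnitAddTorus.mFourier ξ x ∂μT T) atTop
      (𝓝 (∫ x, UnitAddTorus.mFourier ξ x ∂π)) := by
    intro ξ
    have hpos : 0 < ‖torusFourierCoeff h (-ξ)‖ := norm_pos_iff.2 (hfc _)
    rw [tendsto_iff_norm_sub_tendsto_zero]
    have h1 := hlim.div_const ‖torusFourierCoeff h (-ξ)‖
    rw [zero_div] at h1
    refine squeeze_zero' (Eventually.of_forall fun T => norm_nonneg _) ?_ h1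
    filter_upwards [eventually_gt_atTop 0] with T hT
    have := hprob T hT
    have h2 := norm_torusFourierCoeff_mul_le_nhDist hLip.continuous (μT T) π (-ξ)
    rw [neg_neg] at h2
    rwa [le_div_iff₀' hpos]
  have hweak := tendsto_integral_of_tendsto_mFourier
    ((eventually_gt_atTop 0).mono hprob) hF ⟨fun x => (f x : ℂ), by fun_prop⟩
  simp only [ContinuousMap.coe_mk, integral_complex_ofReal] at hweak
  exact_mod_cast (Complex.continuous_re.tendsto _).comp hweak
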